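/- arXiv:1708.05550 — 7 statements merged into one kernel-verified Lean document; each statement's English description precedes it below -/
import Mathlib

section
/- Let d be a positive integer and let w_h, w_v be integers such that gcd(d, w_h, w_v) = 1. If d = gcd(w_h, d) + gcd(w_v, d) + gcd(|w_h − w_v|, d), then d ∈ {3, 4, 6}. (This is the arithmetic content of the statement that a cyclic pillowcase cover X_d(w_h, w_v) branched over exactly three points can have genus one only for degree d = 3, 4 or 6.) -/
/-- If the product of three positive integers `a ≤ b ≤ c` divides their sum, then
`(a, b, c)` is `(1, 1, 1)`, `(1, 1, 2)` or `(1, 2, 3)`, so the sum is `3`, `4` or `6`. -/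
lemma sum_eq_of_mul_dvd_sum_of_le {a b c : ℕ} (ha : 0 < a) (hab : a ≤ b) (hbc : b ≤ c)
    (h : a * b * c ∣ a + b + c) : a + b + c = 3 ∨ a + b + c = 4 ∨ a + b + c = 6 := by
  have hle : a * b * c ≤ a + b + c := Nat.le_of_dvd (by omega) h
  have hmul : a * b ≤ 3 := by
    refine Nat.le_of_mul_le_mul_right (?_ : a * b * c ≤ 3 * c) (by omega)
    omega
  have ha1 : a = 1 := by nlinarith
  subst ha1
  have hb : b ≤ 3 := by omega
  interval_cases b
  · have hc : c ∣ 2 := by simpa using h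
    have := Nat.le_of_dvd two_pos hc
    omega
  · have hc : c ≤ 3 := by omega
    interval_cases c <;> omega
  · omega

/-- If the product of three positive integers divides their sum, the sum is `3`, `4` or `6`. -/
lemma sum_eq_of_mul_dvd_sum {a b c : ℕ} (ha : 0 < a) (hb : 0 < b) (hc : 0 < c)
    (h : a * b * c ∣ a + b + c) : a + b + c = 3 ∨ a + b + c = 4 ∨ a + b + c = 6 := by
  wlog hab : a ≤ b generalizing a b c
  · simpa only [add_comm b a] using
      this hb ha hc (by simpa only [mul_comm b a, add_comm b a] using h) (by omega)
  wlog hbc : b ≤ c generalizing a b c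
  · rcases le_total a c with hac | hca
    · simpa only [add_right_comm a c b] using
        this ha hc hb (by simpa only [mul_right_comm a c b, add_right_comm a c b] using h)
          hac (by omega)
    · have hsum : c + a + b = a + b + c := by ring
      have hprod : c * a * b = a * b * c := by ring
      simpa only [hsum] using this hc ha hb (by rwa [hsum, hprod]) hca hab
  exact sum_eq_of_mul_dvd_sum_of_le ha hab hbc h

/-- If `d` is a positive integer and `w_h, w_v` are integers with
`gcd(d, w_h, w_v) = 1` and `d = gcd(w_h, d) + gcd(w_v, d) + gcd(|w_h - w_v|, d)`,
then `d ∈ {3, 4, 6}`. -/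
theorem stmt_0 (d : ℕ) (hd : 0 < d) (wh wv : ℤ)
    (hconn : Nat.gcd d (Int.gcd wh wv) = 1)
    (h : (d : ℤ) = (Int.gcd wh (d : ℤ) : ℤ) + (Int.gcd wv (d : ℤ) : ℤ) +
      (Int.gcd |wh - wv| (d : ℤ) : ℤ)) :
    d = 3 ∨ d = 4 ∨ d = 6 := by
  have hpos (w : ℤ) : 0 < Int.gcd w d := Int.gcd_pos_of_ne_zero_right w (by omega)
  have hdvd (w : ℤ) : Int.gcd w d ∣ d := Int.natCast_dvd_natCast.mp (Int.gcd_dvd_right w d)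
  have hunit {k : ℕ} (hk : k ∣ d) (hh : (k : ℤ) ∣ wh) (hv : (k : ℤ) ∣ wv) : k = 1 :=
    Nat.dvd_one.mp (hconn ▸ Nat.dvd_gcd hk (Int.dvd_gcd hh hv))
  have hcop {u v : ℤ} (huv : ∀ k : ℤ, k ∣ u → k ∣ v → k ∣ wh ∧ k ∣ wv) :
      Nat.Coprime (Int.gcd u d) (Int.gcd v d) := by
    have hu : ((Nat.gcd (Int.gcd u d) (Int.gcd v d) : ℕ) : ℤ) ∣ u :=
      (Int.natCast_dvd_natCast.mpr (Nat.gcd_dvd_left _ _)).trans (Int.gcd_dvd_left u d)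
    have hv : ((Nat.gcd (Int.gcd u d) (Int.gcd v d) : ℕ) : ℤ) ∣ v :=
      (Int.natCast_dvd_natCast.mpr (Nat.gcd_dvd_right _ _)).trans (Int.gcd_dvd_left v d)
    obtain ⟨h1, h2⟩ := huv _ hu hv
    exact hunit ((Nat.gcd_dvd_left _ _).trans (hdvd u)) h1 h2
  have hab := hcop (u := wh) (v := wv) fun k h1 h2 => ⟨h1, h2⟩
  have hac := hcop (u := wh) (v := |wh - wv|) fun k h1 h2 =>
    ⟨h1, (dvd_sub_right h1).mp ((dvd_abs k _).mp h2)⟩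
  have hbc := hcop (u := wv) (v := |wh - wv|) fun k h1 h2 =>
    ⟨(dvd_sub_left h1).mp ((dvd_abs k _).mp h2), h1⟩
  have hsum : d = Int.gcd wh d + Int.gcd wv d + Int.gcd |wh - wv| d := by exact_mod_cast h
  have hprod : Int.gcd wh d * Int.gcd wv d * Int.gcd |wh - wv| d ∣ d :=
    (hac.mul_left hbc).mul_dvd_of_dvd_of_dvd (hab.mul_dvd_of_dvd_of_dvd (hdvd _) (hdvd _)) (hdvd _)
  have key := sum_eq_of_mul_dvd_sum (hpos wh) (hpos wv) (hpos |wh - wv|) (hsum ▸ hprod)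
  rwa [← hsum] at key
end

section
/- Let G be an abelian group and define σ, τ : G × G → G × G by σ(x, y) = (x, x − y) and τ(x, y) = (y − x, y) (both are bijections of G × G). Then for every (a, b) ∈ G × G, the orbit of (a, b) under the subgroup of bijections of G × G generated by σ and τ equals the set {(a, b), (a, a − b), (b − a, b), (−b, a − b), (b − a, −a), (−b, −a)}. (This is the combinatorial content of the proposition that the SL₂(ℤ)-orbit of a cyclic pillowcase cover X_d(w_h, w_v) is {X_d(w_h,w_v), X_d(w_h,w_h−w_v), X_d(w_v−w_h,w_v), X_d(−w_v,w_h−w_v), X_d(w_v−w_h,−w_h), X_d(−w_v,−w_h)}.) -/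
/-- If the generators of a subgroup of permutations preserve membership in a set, so does every
element of the subgroup. -/
theorem Equiv.Perm.apply_mem_iff_of_mem_closure {α : Type*} {S : Set α} {T : Set (Equiv.Perm α)}
    (hT : ∀ f ∈ T, ∀ p, f p ∈ S ↔ p ∈ S) {g : Equiv.Perm α} (hg : g ∈ Subgroup.closure T) (p : α) :
    g p ∈ S ↔ p ∈ S := by
  induction hg using Subgroup.closure_induction generalizing p with
  | mem f hf => exact hT f hf p
  | one => rfl
  | mul f g _ _ ihf ihg => rw [Equiv.Perm.mul_apply, ihf, ihg]
  | inv f _ ih => rw [← ih, ← Equiv.Perm.mul_apply, mul_inv_cancel, Equiv.Perm.one_apply]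

/-- An involutive map sending a set into itself preserves membership in it. -/
theorem Function.Involutive.apply_mem_iff {α : Type*} {f : α → α} (hf : Function.Involutive f)
    {S : Set α} (h : ∀ p ∈ S, f p ∈ S) (p : α) : f p ∈ S ↔ p ∈ S :=
  ⟨fun hp => hf p ▸ h _ hp, h p⟩

/-- For an abelian group `G`, the orbit of `(a, b) ∈ G × G` under the group of
bijections generated by `σ(x,y) = (x, x - y)` and `τ(x,y) = (y - x, y)` equals
`{(a,b), (a,a-b), (b-a,b), (-b,a-b), (b-a,-a), (-b,-a)}`. -/
theorem stmt_7 {G : Type*} [AddCommGroup G]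
    (eσ eτ : Equiv.Perm (G × G))
    (hσ : ∀ p : G × G, eσ p = (p.1, p.1 - p.2))
    (hτ : ∀ p : G × G, eτ p = (p.2 - p.1, p.2))
    (a b : G) :
    MulAction.orbit ↥(Subgroup.closure ({eσ, eτ} : Set (Equiv.Perm (G × G))))
        ((a, b) : G × G) =
      {(a, b), (a, a - b), (b - a, b), (-b, a - b), (b - a, -a), (-b, -a)} := by
  have hσ_inv : Function.Involutive eσ := fun p => by simp [hσ]
  have hτ_inv : Function.Involutive eτ := fun p => by simp [hτ]
  have neg_sub_sub (x y : G) : -y - (x - y) = -x := by abel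
  apply Set.Subset.antisymm
  · rintro _ ⟨⟨g, hg⟩, rfl⟩
    refine (Equiv.Perm.apply_mem_iff_of_mem_closure ?_ hg (a, b)).2 (by simp)
    rintro f (rfl | rfl)
    · refine hσ_inv.apply_mem_iff ?_
      rintro p (rfl | rfl | rfl | rfl | rfl | rfl) <;> simp [hσ, neg_sub_sub, neg_add_eq_sub]
    · refine hτ_inv.apply_mem_iff ?_
      rintro p (rfl | rfl | rfl | rfl | rfl | rfl) <;> simp [hτ, neg_sub_sub, neg_add_eq_sub]
  · have hσ_mem : eσ ∈ Subgroup.closure {eσ, eτ} := Subgroup.subset_closure (by simp)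
    have hτ_mem : eτ ∈ Subgroup.closure {eσ, eτ} := Subgroup.subset_closure (by simp)
    rintro p (rfl | rfl | rfl | rfl | rfl | rfl)
    · exact MulAction.mem_orbit_self _
    · exact ⟨⟨eσ, hσ_mem⟩, by simp [Subgroup.smul_def, hσ]⟩
    · exact ⟨⟨eτ, hτ_mem⟩, by simp [Subgroup.smul_def, hτ]⟩
    · exact ⟨⟨eτ * eσ, mul_mem hτ_mem hσ_mem⟩, by simp [Subgroup.smul_def, hσ, hτ]⟩
    · exact ⟨⟨eσ * eτ, mul_mem hσ_mem hτ_mem⟩, by simp [Subgroup.smul_def, hσ, hτ]⟩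
    · exact ⟨⟨eσ * (eτ * eσ), mul_mem hσ_mem (mul_mem hτ_mem hσ_mem)⟩,
        by simp [Subgroup.smul_def, hσ, hτ, neg_sub_sub]⟩
end

section
/- Let (X, ρ) be a compact metric space with Borel σ-algebra B, μ a Borel probability measure on X, and T : X → X an invertible μ-preserving ergodic transformation. Suppose there exist an increasing sequence of natural numbers (h_n) and Borel sets (C_n) such that μ(C_n) → α for some α > 0, μ(C_n Δ T⁻¹C_n) → 0, and sup_{x ∈ C_n} ρ(x, T^{h_n}x) → 0 as n → ∞. If ψ : X → ℤ^d is a measurable function and g ∈ ℤ^d is such that ψ^{(h_n)}(x) = g for all x ∈ C_n and all n, then g is an essential value of ψ, i.e. g ∈ E(ψ). -/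
open MeasureTheory Filter Topology

/-- The cocycle `ψ^{(n)}(x) = Σ_{0 ≤ j < n} ψ(T^j x)` for `n ≥ 0` and
`ψ^{(n)}(x) = -Σ_{n ≤ j < 0} ψ(T^j x)` for `n < 0`, for an invertible
transformation `T`. -/
def cocycle {X G : Type*} [AddCommGroup G] (T : Equiv.Perm X) (ψ : X → G)
    (n : ℤ) (x : X) : G :=
  if 0 ≤ n then ∑ j ∈ Finset.range n.toNat, ψ ((T ^ (j : ℤ)) x)
  else -∑ j ∈ Finset.range (-n).toNat, ψ ((T ^ (n + (j : ℤ))) x)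

/-- `g` is an essential value of the cocycle generated by `ψ : X → G` over `T`
(`G` a discrete abelian group): for every positive-measure Borel set `B` there
is `n ∈ ℤ` with `μ(B ∩ T⁻ⁿB ∩ {x : ψ⁽ⁿ⁾(x) = g}) > 0`. -/
def IsEssentialValue {X G : Type*} [AddCommGroup G] [MeasurableSpace X]
    (μ : Measure X) (T : Equiv.Perm X) (ψ : X → G) (g : G) : Prop :=
  ∀ B : Set X, MeasurableSet B → 0 < μ B →
    ∃ n : ℤ, 0 < μ (B ∩ ⇑(T ^ n) ⁻¹' B ∩ {x | cocycle T ψ n x = g})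

/-- The sets almost invariant under one step remain so under `k` steps, with linear loss. -/
lemma MeasureTheory.MeasurePreserving.measureReal_diff_preimage_iterate_le {X : Type*}
    [MeasurableSpace X] {μ : Measure X} [IsFiniteMeasure μ] {f : X → X}
    (hf : MeasurePreserving f μ μ) {C : Set X} (hC : MeasurableSet C) (k : ℕ) :
    μ.real (C \ f^[k] ⁻¹' C) ≤ k * μ.real (C \ f ⁻¹' C) := by
  induction k with
  | zero => simp
  | succ k ih =>
    have hsub : C \ f^[k + 1] ⁻¹' C ⊆ (C \ f^[k] ⁻¹' C) ∪ f^[k] ⁻¹' (C \ f ⁻¹' C) := by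
      rintro x ⟨hx, hx'⟩
      rw [Function.iterate_succ', Set.mem_preimage, Function.comp_apply] at hx'
      by_cases h : f^[k] x ∈ C
      · exact Or.inr ⟨h, hx'⟩
      · exact Or.inl ⟨hx, h⟩
    have hpre : μ.real (f^[k] ⁻¹' (C \ f ⁻¹' C)) = μ.real (C \ f ⁻¹' C) :=
      (hf.iterate k).measureReal_preimage (hC.diff (hf.measurable hC)).nullMeasurableSet
    calc μ.real (C \ f^[k + 1] ⁻¹' C)
        ≤ μ.real ((C \ f^[k] ⁻¹' C) ∪ f^[k] ⁻¹' (C \ f ⁻¹' C)) := measureReal_mono hsub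
      _ ≤ μ.real (C \ f^[k] ⁻¹' C) + μ.real (f^[k] ⁻¹' (C \ f ⁻¹' C)) :=
          measureReal_union_le _ _
      _ ≤ (k + 1 : ℕ) * μ.real (C \ f ⁻¹' C) := by
          rw [hpre]; push_cast; linarith

/-- The preimages of a set of positive measure under an ergodic map cover almost everything. -/
lemma Ergodic.iUnion_preimage_iterate_ae_eq_univ {X : Type*} [MeasurableSpace X]
    {μ : Measure X} [IsFiniteMeasure μ] {f : X → X} (hf : Ergodic f μ) {B : Set X}
    (hB : MeasurableSet B) (hB0 : 0 < μ B) :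
    (⋃ k : ℕ, f^[k] ⁻¹' B) =ᵐ[μ] Set.univ := by
  have hmeas : MeasurableSet (⋃ k : ℕ, f^[k] ⁻¹' B) :=
    MeasurableSet.iUnion fun k => hf.measurable.iterate k hB
  have hsub : f ⁻¹' (⋃ k : ℕ, f^[k] ⁻¹' B) ⊆ ⋃ k : ℕ, f^[k] ⁻¹' B := by
    intro x hx
    simp only [Set.mem_preimage, Set.mem_iUnion] at hx ⊢
    obtain ⟨k, hk⟩ := hx
    exact ⟨k + 1, hk⟩
  refine (hf.ae_empty_or_univ_of_preimage_ae_le hmeas.nullMeasurableSet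
    hsub.eventuallyLE).resolve_left fun h => ?_
  have h0 : μ (⋃ k : ℕ, f^[k] ⁻¹' B) = 0 := ae_eq_empty.mp h
  exact hB0.ne' (measure_mono_null (Set.subset_iUnion (fun k : ℕ => f^[k] ⁻¹' B) 0) h0)

/-- Asymptotically invariant sets of non-vanishing measure meet every set of positive measure
in a uniformly non-negligible set. -/
lemma Ergodic.exists_pos_eventually_lt_measureReal_inter {X : Type*} [MeasurableSpace X]
    {μ : Measure X} [IsProbabilityMeasure μ] {f : X → X} (hf : Ergodic f μ)
    {C : ℕ → Set X} (hC : ∀ n, MeasurableSet (C n)) {α : ℝ} (hα : 0 < α)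
    (hCα : Tendsto (fun n => μ.real (C n)) atTop (𝓝 α))
    (hinv : Tendsto (fun n => μ.real (C n \ f ⁻¹' C n)) atTop (𝓝 0))
    {B : Set X} (hB : MeasurableSet B) (hB0 : 0 < μ B) :
    ∃ c : ℝ, 0 < c ∧ ∀ᶠ n in atTop, c < μ.real (C n ∩ B) := by
  have hmB : ∀ k : ℕ, MeasurableSet (f^[k] ⁻¹' B) := fun k => hf.measurable.iterate k hB
  obtain ⟨K, hK⟩ : ∃ K : ℕ, 1 - α / 2 < μ.real (Set.accumulate (fun k => f^[k] ⁻¹' B) K) := by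
    have h1 := tendsto_measure_iUnion_accumulate (μ := μ) (f := fun k : ℕ => f^[k] ⁻¹' B)
    rw [measure_congr (hf.iUnion_preimage_iterate_ae_eq_univ hB hB0), measure_univ] at h1
    have h2 := (ENNReal.tendsto_toReal ENNReal.one_ne_top).comp h1
    rw [ENNReal.toReal_one] at h2
    exact (h2.eventually (lt_mem_nhds (by linarith : 1 - α / 2 < 1))).exists
  set U := Set.accumulate (fun k => f^[k] ⁻¹' B) K with hU
  have hUeq : U = ⋃ k ∈ Finset.range (K + 1), f^[k] ⁻¹' B := by
    ext x; simp [hU, Set.mem_accumulate]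
  have hmU : MeasurableSet U := by
    rw [hUeq]; exact Finset.measurableSet_biUnion _ fun k _ => hmB k
  have hUc : μ.real Uᶜ < α / 2 := by
    rw [probReal_compl_eq_one_sub hmU]; linarith
  have hstep : ∀ n, ∀ k ∈ Finset.range (K + 1), μ.real (C n ∩ f^[k] ⁻¹' B) ≤
      μ.real (C n ∩ B) + (K + 1) * μ.real (C n \ f ⁻¹' C n) := by
    intro n k hk
    have hsub : C n ∩ f^[k] ⁻¹' B ⊆ f^[k] ⁻¹' (C n ∩ B) ∪ (C n \ f^[k] ⁻¹' C n) := by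
      rintro x ⟨hx, hxB⟩
      by_cases h : f^[k] x ∈ C n
      · exact Or.inl ⟨h, hxB⟩
      · exact Or.inr ⟨hx, h⟩
    have hpre : μ.real (f^[k] ⁻¹' (C n ∩ B)) = μ.real (C n ∩ B) :=
      (hf.toMeasurePreserving.iterate k).measureReal_preimage
        ((hC n).inter hB).nullMeasurableSet
    have hkK : (k : ℝ) ≤ K + 1 := by exact_mod_cast (Finset.mem_range.mp hk).le
    calc μ.real (C n ∩ f^[k] ⁻¹' B)
        ≤ μ.real (f^[k] ⁻¹' (C n ∩ B)) + μ.real (C n \ f^[k] ⁻¹' C n) :=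
          (measureReal_mono hsub).trans (measureReal_union_le _ _)
      _ ≤ μ.real (C n ∩ B) + k * μ.real (C n \ f ⁻¹' C n) := by
          rw [hpre]
          gcongr
          exact hf.toMeasurePreserving.measureReal_diff_preimage_iterate_le (hC n) k
      _ ≤ _ := by gcongr
  have hmain : ∀ n, μ.real (C n) ≤ α / 2 +
      (K + 1) * (μ.real (C n ∩ B) + (K + 1) * μ.real (C n \ f ⁻¹' C n)) := by
    intro n
    have hsub : C n ⊆ Uᶜ ∪ ⋃ k ∈ Finset.range (K + 1), C n ∩ f^[k] ⁻¹' B := by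
      intro x hx
      by_cases h : x ∈ U
      · right
        rw [hUeq] at h
        simp only [Set.mem_iUnion] at h ⊢
        obtain ⟨k, hk, hkx⟩ := h
        exact ⟨k, hk, hx, hkx⟩
      · exact Or.inl h
    calc μ.real (C n)
        ≤ μ.real Uᶜ + μ.real (⋃ k ∈ Finset.range (K + 1), C n ∩ f^[k] ⁻¹' B) :=
          (measureReal_mono hsub).trans (measureReal_union_le _ _)
      _ ≤ α / 2 + ∑ k ∈ Finset.range (K + 1), μ.real (C n ∩ f^[k] ⁻¹' B) :=
          add_le_add hUc.le (measureReal_biUnion_finset_le _ _)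
      _ ≤ _ := by
          gcongr
          refine (Finset.sum_le_card_nsmul _ _ _ (hstep n)).trans_eq ?_
          simp [mul_add]
  refine ⟨α / (4 * (K + 1)), by positivity, ?_⟩
  have hlim : Tendsto (fun n => μ.real (C n) - α / 2 -
      (K + 1) * ((K + 1) * μ.real (C n \ f ⁻¹' C n))) atTop
      (𝓝 (α - α / 2 - (K + 1) * ((K + 1) * 0))) :=
    (hCα.sub_const _).sub ((hinv.const_mul _).const_mul _)
  filter_upwards [hlim.eventually (lt_mem_nhds (by linarith : α / 4 < _))] with n hn
  have := hmain n
  rw [div_lt_iff₀ (by positivity)]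
  linarith

/-- Essential value criterion of Conze–Frączek: if `(C_n)` are Borel sets of
measure tending to `α > 0`, almost invariant in the limit, with
`sup_{x ∈ C_n} dist(x, T^{h_n} x) → 0`, and the Birkhoff sums `ψ^{(h_n)}`
are constantly `g` on `C_n`, then `g` is an essential value of `ψ`. -/
theorem stmt_8 {X : Type*} [MetricSpace X] [CompactSpace X]
    [MeasurableSpace X] [BorelSpace X] {d : ℕ}
    (μ : Measure X) [IsProbabilityMeasure μ]
    (T : Equiv.Perm X) (hT : Measurable T) (hTinv : Measurable T.symm)
    (herg : Ergodic T μ)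
    (ψ : X → Fin d → ℤ) (hψ : Measurable ψ)
    (h : ℕ → ℕ) (hmono : StrictMono h)
    (C : ℕ → Set X) (hCmeas : ∀ n, MeasurableSet (C n))
    (α : ℝ) (hα : 0 < α)
    (hC : Tendsto (fun n => μ (C n)) atTop (𝓝 (ENNReal.ofReal α)))
    (hsym : Tendsto (fun n => μ (symmDiff (C n) (⇑T ⁻¹' C n))) atTop (𝓝 0))
    (hdist : Tendsto (fun n => ⨆ x ∈ C n, dist x ((T ^ ((h n : ℕ) : ℤ)) x))
      atTop (𝓝 0))
    (g : Fin d → ℤ)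
    (hg : ∀ n : ℕ, ∀ x ∈ C n, cocycle T ψ ((h n : ℕ) : ℤ) x = g) :
    IsEssentialValue μ T ψ g := by
  intro B hB hB0
  obtain ⟨F, hFB, hFc, hF0⟩ :=
    MeasurableSet.exists_lt_isClosed_of_ne_top hB (measure_ne_top μ B) hB0
  have hinv : Tendsto (fun n => μ.real (C n \ T ⁻¹' C n)) atTop (𝓝 0) := by
    have h0 := (ENNReal.tendsto_toReal ENNReal.zero_ne_top).comp hsym
    rw [ENNReal.toReal_zero] at h0
    exact squeeze_zero (fun _ => measureReal_nonneg)
      (fun n => measureReal_mono (μ := μ) (s₂ := symmDiff (C n) (T ⁻¹' C n))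
        Set.subset_union_left) h0
  have hCα : Tendsto (fun n => μ.real (C n)) atTop (𝓝 α) := by
    have h0 := (ENNReal.tendsto_toReal ENNReal.ofReal_ne_top).comp hC
    rwa [ENNReal.toReal_ofReal hα.le] at h0
  obtain ⟨c, hc, hev⟩ := herg.exists_pos_eventually_lt_measureReal_inter hCmeas hα hCα hinv
    hFc.measurableSet hF0
  obtain ⟨δ, hδ, hδF⟩ : ∃ δ : ℝ, 0 < δ ∧ μ.real (Metric.cthickening δ F) < μ.real F + c := by
    have h1 : Tendsto (fun r => μ (Metric.cthickening r F)) (𝓝 0) (𝓝 (μ F)) :=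
      tendsto_measure_cthickening_of_isClosed ⟨1, one_pos, measure_ne_top _ _⟩ hFc
    have h2 := (ENNReal.tendsto_toReal (measure_ne_top μ F)).comp h1
    have h3 := (h2.mono_left (nhdsWithin_le_nhds (s := Set.Ioi 0))).eventually
      (gt_mem_nhds (lt_add_of_pos_right _ hc))
    obtain ⟨δ, h4, h5⟩ := (h3.and self_mem_nhdsWithin).exists
    exact ⟨δ, h5, h4⟩
  obtain ⟨n, hn, hnδ⟩ := (hev.and (hdist.eventually (gt_mem_nhds hδ))).exists
  refine ⟨(h n : ℤ), ?_⟩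
  have hmp : MeasurePreserving (T ^ (h n : ℤ)) μ μ := by
    rw [zpow_natCast, Equiv.Perm.coe_pow]
    exact herg.toMeasurePreserving.iterate (h n)
  set S := ⇑(T ^ (h n : ℤ)) with hS
  have hclose : ∀ x ∈ C n, dist x (S x) ≤ δ := by
    intro x hx
    have hb : BddAbove (Set.range fun x => ⨆ _ : x ∈ C n, dist x (S x)) := by
      refine ⟨Metric.diam (Set.univ : Set X), ?_⟩
      rintro _ ⟨y, rfl⟩
      exact Real.iSup_le (fun _ => Metric.dist_le_diam_of_mem isCompact_univ.isBounded
        (Set.mem_univ _) (Set.mem_univ _)) Metric.diam_nonneg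
    refine le_trans ?_ hnδ.le
    refine le_trans ?_ (le_ciSup hb x)
    simp [hx]
  have hsub : C n ∩ F ⊆ (B ∩ S ⁻¹' B ∩ {x | cocycle T ψ (h n : ℤ) x = g}) ∪
      S ⁻¹' (Metric.cthickening δ F \ F) := by
    rintro x ⟨hx, hxF⟩
    by_cases hSx : S x ∈ F
    · exact Or.inl ⟨⟨hFB hxF, hFB hSx⟩, hg n x hx⟩
    · refine Or.inr ⟨Metric.mem_cthickening_of_dist_le _ x _ _ hxF ?_, hSx⟩
      rw [dist_comm]
      exact hclose x hx
  have hpre : μ.real (S ⁻¹' (Metric.cthickening δ F \ F)) < c := by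
    rw [hmp.measureReal_preimage
      (Metric.isClosed_cthickening.measurableSet.diff hFc.measurableSet).nullMeasurableSet,
      measureReal_sdiff (Metric.self_subset_cthickening F) hFc.measurableSet]
    linarith
  have hle := (measureReal_mono (μ := μ) hsub).trans (measureReal_union_le _ _)
  exact (ENNReal.toReal_pos_iff.mp (lt_of_not_ge fun h0 => by
    rw [← measureReal_def] at h0
    linarith)).1
end

section
/- Let T be an invertible measure-preserving ergodic transformation of a standard Borel probability space (X, B, μ) and let ψ : X → ℤ^d be measurable. Then the set E(ψ) of essential values of ψ is a subgroup of ℤ^d; in particular 0 ∈ E(ψ), E(ψ) is closed under negation, and E(ψ) is closed under addition. -/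
open MeasureTheory Filter Topology

theorem cocycle_natCast {X G : Type*} [AddCommGroup G] (T : Equiv.Perm X) (ψ : X → G)
    (k : ℕ) (x : X) :
    cocycle T ψ k x = ∑ j ∈ Finset.range k, ψ ((T ^ (j : ℤ)) x) := by
  simp [cocycle]

theorem cocycle_neg_natCast {X G : Type*} [AddCommGroup G] (T : Equiv.Perm X) (ψ : X → G)
    (k : ℕ) (x : X) :
    cocycle T ψ (-(k : ℤ)) x =
      -∑ j ∈ Finset.range k, ψ ((T ^ (-(k : ℤ) + (j : ℤ))) x) := by
  rcases Nat.eq_zero_or_pos k with rfl | hk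
  · simp [cocycle]
  · rw [cocycle, if_neg (by lia)]
    simp

theorem cocycle_zero {X G : Type*} [AddCommGroup G] (T : Equiv.Perm X) (ψ : X → G) (x : X) :
    cocycle T ψ 0 x = 0 := by
  simp [cocycle]

theorem cocycle_add_one {X G : Type*} [AddCommGroup G] (T : Equiv.Perm X) (ψ : X → G)
    (n : ℤ) (x : X) :
    cocycle T ψ (n + 1) x = cocycle T ψ n x + ψ ((T ^ n) x) := by
  rcases lt_or_ge n 0 with hn | hn
  · obtain ⟨k, rfl⟩ : ∃ k : ℕ, n = -((k + 1 : ℕ) : ℤ) := ⟨(-n - 1).toNat, by lia⟩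
    have h1 : -((k + 1 : ℕ) : ℤ) + 1 = -(k : ℤ) := by lia
    rw [h1, cocycle_neg_natCast, cocycle_neg_natCast, Finset.sum_range_succ']
    have h2 (j : ℕ) : -((k + 1 : ℕ) : ℤ) + ((j + 1 : ℕ) : ℤ) = -(k : ℤ) + j := by lia
    simp only [h2, Nat.cast_zero, add_zero]
    abel
  · lift n to ℕ using hn
    rw [← Nat.cast_succ, cocycle_natCast, cocycle_natCast, Finset.sum_range_succ]

theorem cocycle_add {X G : Type*} [AddCommGroup G] (T : Equiv.Perm X) (ψ : X → G)
    (m n : ℤ) (x : X) :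
    cocycle T ψ (m + n) x = cocycle T ψ m ((T ^ n) x) + cocycle T ψ n x := by
  have hstep (i : ℤ) : ψ ((T ^ i) ((T ^ n) x)) = ψ ((T ^ (i + n)) x) := by
    rw [zpow_add, Equiv.Perm.mul_apply]
  induction m using Int.induction_on with
  | zero => simp [cocycle_zero]
  | succ i ih =>
    rw [add_right_comm, cocycle_add_one, cocycle_add_one, ih, hstep]
    abel
  | pred i ih =>
    have h1 := cocycle_add_one T ψ (-(i : ℤ) - 1 + n) x
    have h2 := cocycle_add_one T ψ (-(i : ℤ) - 1) ((T ^ n) x)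
    rw [show -(i : ℤ) - 1 + n + 1 = -(i : ℤ) + n by ring, ih] at h1
    rw [sub_add_cancel, hstep] at h2
    rw [h2] at h1
    apply add_right_cancel (b := ψ ((T ^ (-(i : ℤ) - 1 + n)) x))
    rw [← h1]
    abel

theorem cocycle_neg_apply_zpow {X G : Type*} [AddCommGroup G] (T : Equiv.Perm X) (ψ : X → G)
    (n : ℤ) (x : X) :
    cocycle T ψ (-n) ((T ^ n) x) = -cocycle T ψ n x := by
  have h := cocycle_add T ψ (-n) n x
  rw [neg_add_cancel, cocycle_zero] at h
  exact eq_neg_of_add_eq_zero_left h.symm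

theorem measurePreserving_perm_zpow {X : Type*} [MeasurableSpace X] {μ : Measure X}
    {T : Equiv.Perm X} (hT : MeasurePreserving T μ μ) (hTinv : Measurable T.symm) (n : ℤ) :
    MeasurePreserving ⇑(T ^ n) μ μ := by
  have hnat (S : Equiv.Perm X) (hS : MeasurePreserving S μ μ) (k : ℕ) :
      MeasurePreserving ⇑(S ^ k) μ μ := by
    rw [Equiv.Perm.coe_pow]
    exact hS.iterate k
  have hsymm : MeasurePreserving ⇑T⁻¹ μ μ :=
    MeasurePreserving.symm (⟨T, hT.measurable, hTinv⟩ : X ≃ᵐ X) hT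
  obtain ⟨k, rfl | rfl⟩ := n.eq_nat_or_neg
  · simpa using hnat T hT k
  · simpa using hnat T⁻¹ hsymm k

theorem measurable_cocycle {X G : Type*} [AddCommGroup G] [MeasurableSpace X]
    [MeasurableSpace G] [MeasurableAdd₂ G] [MeasurableNeg G] {T : Equiv.Perm X} {ψ : X → G}
    (hT : ∀ n : ℤ, Measurable ⇑(T ^ n)) (hψ : Measurable ψ) (n : ℤ) :
    Measurable (cocycle T ψ n) := by
  unfold cocycle
  split_ifs
  · exact Finset.measurable_sum _ fun j _ => hψ.comp (hT j)
  · exact measurable_neg.comp (Finset.measurable_sum _ fun j _ => hψ.comp (hT (n + j)))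

theorem isEssentialValue_zero {X G : Type*} [AddCommGroup G] [MeasurableSpace X]
    (μ : Measure X) (T : Equiv.Perm X) (ψ : X → G) : IsEssentialValue μ T ψ 0 :=
  fun B _ hB => ⟨0, by simpa [cocycle_zero] using hB⟩

theorem IsEssentialValue.neg {X G : Type*} [AddCommGroup G] [MeasurableSpace X]
    {μ : Measure X} {T : Equiv.Perm X} {ψ : X → G} {g : G}
    (hT : ∀ n : ℤ, MeasurePreserving ⇑(T ^ n) μ μ)
    (hg : IsEssentialValue μ T ψ g) : IsEssentialValue μ T ψ (-g) := by
  intro B hB hpos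
  obtain ⟨n, hn⟩ := hg B hB hpos
  refine ⟨-n, hn.trans_le ?_⟩
  refine (measure_mono ?_).trans ((hT n).measure_preimage_le _)
  rintro x ⟨⟨hx, hxn⟩, hxg⟩
  refine ⟨⟨hxn, ?_⟩, ?_⟩
  · simpa [zpow_neg] using hx
  · rw [Set.mem_ofPred_eq, cocycle_neg_apply_zpow, hxg.out]

theorem IsEssentialValue.add {X G : Type*} [AddCommGroup G] [MeasurableSpace X]
    [MeasurableSpace G] [MeasurableSingletonClass G] [MeasurableAdd₂ G] [MeasurableNeg G]
    {μ : Measure X} {T : Equiv.Perm X} {ψ : X → G} {g g' : G}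
    (hT : ∀ n : ℤ, Measurable ⇑(T ^ n)) (hψ : Measurable ψ)
    (hg : IsEssentialValue μ T ψ g) (hg' : IsEssentialValue μ T ψ g') :
    IsEssentialValue μ T ψ (g + g') := by
  intro B hB hpos
  obtain ⟨n, hn⟩ := hg B hB hpos
  obtain ⟨m, hm⟩ := hg' _ ((hB.inter (hT n hB)).inter
    (measurable_cocycle hT hψ n (measurableSet_singleton g))) hn
  refine ⟨n + m, hm.trans_le (measure_mono ?_)⟩
  rintro x ⟨⟨⟨⟨hx, -⟩, -⟩, ⟨⟨-, hxn⟩, hxg⟩⟩, hxg'⟩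
  refine ⟨⟨hx, ?_⟩, ?_⟩
  · rw [Set.mem_preimage, zpow_add, Equiv.Perm.mul_apply]
    exact hxn
  · rw [Set.mem_ofPred_eq, cocycle_add, hxg'.out, hxg.out]

/-- The set `E(ψ)` of essential values of a measurable cocycle `ψ : X → ℤ^d`
over an invertible measure-preserving ergodic transformation of a standard
Borel probability space is a subgroup of `ℤ^d`: it contains `0` and is closed
under negation and addition. -/
theorem stmt_9 {X : Type*} [MeasurableSpace X] [StandardBorelSpace X] {d : ℕ}
    (μ : Measure X) [IsProbabilityMeasure μ]
    (T : Equiv.Perm X) (hT : Measurable T) (hTinv : Measurable T.symm)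
    (herg : Ergodic T μ)
    (ψ : X → Fin d → ℤ) (hψ : Measurable ψ) :
    IsEssentialValue μ T ψ 0 ∧
    (∀ g : Fin d → ℤ, IsEssentialValue μ T ψ g → IsEssentialValue μ T ψ (-g)) ∧
    (∀ g g' : Fin d → ℤ, IsEssentialValue μ T ψ g → IsEssentialValue μ T ψ g' →
      IsEssentialValue μ T ψ (g + g')) := by
  have hpow := measurePreserving_perm_zpow herg.toMeasurePreserving hTinv
  exact ⟨isEssentialValue_zero μ T ψ, fun _ hg => hg.neg hpow,
    fun _ _ hg hg' => hg.add (fun n => (hpow n).measurable) hψ hg'⟩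
end

section
/- Let T be an interval exchange transformation of an interval I ⊂ ℝ with exchanged intervals (I_β)_{β∈B} (so T restricted to each I_β is a translation), and let ψ : I → ℤ^d be constant on each I_β. Let J ⊆ I be a subinterval, let (J_α)_{α∈A} be a finite partition of J into intervals and (h_α)_{α∈A} positive integers such that for every x ∈ J_α the first return time of x to J under T equals h_α (i.e. T^{h_α}x ∈ J and T^j x ∉ J for 0 < j < h_α). Suppose h is a natural number with h ≤ min_α h_α such that for every 0 ≤ j < h the image T^j(J) is contained in a single interval I_β. Then for every α ∈ A and every x ∈ C_α := ⋃_{0≤j≤h} T^j(J_α): the Birkhoff sum ψ^{(h_α)}(x) equals ψ^{(h_α)}(x₀), where x = T^j x₀ with x₀ ∈ J_α and 0 ≤ j ≤ h (so ψ^{(h_α)} is constant on C_α), and |T^{h_α}x − x| ≤ |J|, where |J| is the length of J. -/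
open Function

/-- Combinatorial lemma on interval exchange transformations (Lemma on induced
cocycles): let `T` be an IET of `I = ⋃ Iβ` translating each interval `Iβ`, and
`ψ` constant on each `Iβ`. Let `J = [a, b) ⊆ I` be a subinterval partitioned
into intervals `Jα` with constant first return time `hα` to `J`, and let
`h ≤ min hα` be such that each `T^j(J)`, `0 ≤ j < h`, lies in a single `Iβ`.
Then on each tower piece `C_α = ⋃_{0 ≤ j ≤ h} T^j(Jα)`, the Birkhoff sum
`ψ^{(hα)}` is constant (equal to its value at the base point) and
`|T^{hα}x − x| ≤ |J| = b − a`. -/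
theorem stmt_11 {B A : Type*} [Fintype B] [Fintype A] {d : ℕ}
    (I : Set ℝ) (Iβ : B → Set ℝ)
    (hIpart : I = ⋃ β, Iβ β)
    (hIdisj : Pairwise (Function.onFun Disjoint Iβ))
    (hIint : ∀ β, ∃ p q : ℝ, Iβ β = Set.Ico p q)
    (T : ℝ → ℝ) (hTbij : Set.BijOn T I I)
    (hTtrans : ∀ β, ∃ c : ℝ, ∀ x ∈ Iβ β, T x = x + c)
    (ψ : ℝ → Fin d → ℤ)
    (hψconst : ∀ β, ∀ x ∈ Iβ β, ∀ y ∈ Iβ β, ψ x = ψ y)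
    (a b : ℝ) (J : Set ℝ) (hJ : J = Set.Ico a b) (hJI : J ⊆ I)
    (Jα : A → Set ℝ)
    (hJpart : J = ⋃ α, Jα α)
    (hJdisj : Pairwise (Function.onFun Disjoint Jα))
    (hJint : ∀ α, ∃ p q : ℝ, Jα α = Set.Ico p q)
    (hα : A → ℕ) (hαpos : ∀ α, 0 < hα α)
    (hret : ∀ α, ∀ x ∈ Jα α,
      T^[hα α] x ∈ J ∧ ∀ j : ℕ, 0 < j → j < hα α → T^[j] x ∉ J)
    (h : ℕ) (hmin : ∀ α, h ≤ hα α)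
    (hcont : ∀ j < h, ∃ β, T^[j] '' J ⊆ Iβ β) :
    ∀ α, ∀ x₀ ∈ Jα α, ∀ j ≤ h,
      (∑ i ∈ Finset.range (hα α), ψ (T^[i] (T^[j] x₀))) =
        (∑ i ∈ Finset.range (hα α), ψ (T^[i] x₀)) ∧
      |T^[hα α] (T^[j] x₀) - T^[j] x₀| ≤ b - a := by
  intro α x₀ hx₀ j hj
  have hx₀J : x₀ ∈ J := hJpart ▸ Set.mem_iUnion_of_mem α hx₀
  have hyJ : T^[hα α] x₀ ∈ J := (hret α x₀ hx₀).1
  have hψ : ∀ i < h, ψ (T^[i] (T^[hα α] x₀)) = ψ (T^[i] x₀) := by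
    intro i hi
    obtain ⟨β, hβ⟩ := hcont i hi
    exact hψconst β _ (hβ (Set.mem_image_of_mem _ hyJ)) _ (hβ (Set.mem_image_of_mem _ hx₀J))
  have hT : ∀ i ≤ h, T^[i] (T^[hα α] x₀) - T^[i] x₀ = T^[hα α] x₀ - x₀ := by
    intro i
    induction i with
    | zero => intro _; rfl
    | succ i ih =>
      intro hi
      obtain ⟨β, hβ⟩ := hcont i hi
      obtain ⟨c, hc⟩ := hTtrans β
      rw [iterate_succ_apply', iterate_succ_apply',
        hc _ (hβ (Set.mem_image_of_mem _ hyJ)), hc _ (hβ (Set.mem_image_of_mem _ hx₀J)),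
        add_sub_add_right_eq_sub, ih (Nat.le_of_succ_le hi)]
  refine ⟨?_, ?_⟩
  · induction j with
    | zero => rfl
    | succ j ih =>
      rw [← ih (Nat.le_of_succ_le hj)]
      have hlast : ψ (T^[hα α] (T^[j] x₀)) = ψ (T^[0] (T^[j] x₀)) := by
        rw [← iterate_add_apply, add_comm, iterate_add_apply, hψ j hj, iterate_zero_apply]
      have hshift := (Finset.sum_range_succ' (fun i => ψ (T^[i] (T^[j] x₀))) (hα α)).symm.trans
        (Finset.sum_range_succ (fun i => ψ (T^[i] (T^[j] x₀))) (hα α))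
      rw [hlast] at hshift
      rw [← add_right_cancel hshift]
      simp only [iterate_succ_apply, ← iterate_succ_apply' T j x₀]
  · rw [← iterate_add_apply, add_comm, iterate_add_apply, hT j hj]
    rw [hJ] at hx₀J hyJ
    exact abs_sub_le_iff.2 ⟨by linarith [hyJ.2, hx₀J.1], by linarith [hyJ.1, hx₀J.2]⟩
end

section
/- Let 0 < r₀ < R be real numbers and set c = r₀(2R − r₀). Then for every real u with r₀ < u < 2R − r₀, the function F(u) = arcsin((R·u − c)/(u·(R − r₀))) is differentiable at u with derivative F′(u) = √c / (u · √(u(2R − u) − c)). (This is the antiderivative identity used to integrate the geodesic equation dr/dθ inside an Eaton lens of radius R.) -/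
/-- Antiderivative identity for the geodesic equation inside an Eaton lens:
with `c = r₀(2R − r₀)` and `r₀ < u < 2R − r₀`, the function
`u ↦ arcsin((Ru − c)/(u(R − r₀)))` has derivative `√c / (u √(u(2R − u) − c))`. -/
theorem stmt_12 (R r₀ : ℝ) (h0 : 0 < r₀) (hR : r₀ < R) (u : ℝ)
    (hu1 : r₀ < u) (hu2 : u < 2 * R - r₀) :
    HasDerivAt (fun v : ℝ =>
        Real.arcsin ((R * v - r₀ * (2 * R - r₀)) / (v * (R - r₀))))
      (Real.sqrt (r₀ * (2 * R - r₀)) /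
        (u * Real.sqrt (u * (2 * R - u) - r₀ * (2 * R - r₀)))) u := by
  have hu : 0 < u := h0.trans hu1
  have ha : 0 < R - r₀ := sub_pos.2 hR
  have hb : 0 < 2 * R - r₀ := by linarith
  have hc : 0 < r₀ * (2 * R - r₀) := mul_pos h0 hb
  have hw : 0 < u * (2 * R - u) - r₀ * (2 * R - r₀) := by
    nlinarith [mul_pos (sub_pos.2 hu1) (sub_pos.2 hu2)]
  have hua : 0 < u * (R - r₀) := mul_pos hu ha
  have hlt : (R * u - r₀ * (2 * R - r₀)) / (u * (R - r₀)) < 1 := by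
    rw [div_lt_one hua]
    nlinarith [mul_pos h0 (sub_pos.2 hu2)]
  have hgt : -1 < (R * u - r₀ * (2 * R - r₀)) / (u * (R - r₀)) := by
    rw [lt_div_iff₀ hua]
    nlinarith [mul_pos hb (sub_pos.2 hu1)]
  have hsqrt : √(1 - ((R * u - r₀ * (2 * R - r₀)) / (u * (R - r₀))) ^ 2) =
      √(r₀ * (2 * R - r₀)) * √(u * (2 * R - u) - r₀ * (2 * R - r₀)) / (u * (R - r₀)) := by
    rw [← Real.sqrt_mul hc.le, ← Real.sqrt_sq hua.le, ← Real.sqrt_div' _ (sq_nonneg _),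
      Real.sqrt_sq hua.le]
    congr 1
    field_simp
    ring
  have hinner : HasDerivAt (fun v : ℝ => (R * v - r₀ * (2 * R - r₀)) / (v * (R - r₀)))
      (r₀ * (2 * R - r₀) / (u ^ 2 * (R - r₀))) u := by
    refine ((((hasDerivAt_id u).const_mul R).sub_const _).div
      ((hasDerivAt_id u).mul_const (R - r₀)) hua.ne').congr_deriv ?_
    simp only [id]
    field_simp
    ring
  refine ((Real.hasDerivAt_arcsin hgt.ne' hlt.ne).comp u hinner).congr_deriv ?_
  rw [hsqrt]
  have hsc := Real.sqrt_pos.2 hc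
  have hsw := Real.sqrt_pos.2 hw
  have hsq := Real.sq_sqrt hc.le
  generalize √(u * (2 * R - u) - r₀ * (2 * R - r₀)) = w at *
  generalize √(r₀ * (2 * R - r₀)) = s at *
  rw [← hsq]
  field_simp
end

section
/- Let R, r₀, r, φ be real numbers with 0 < r₀ < R and r > 0, and suppose that cos φ = −(R·r − r₀(2R − r₀)) / (r·(R − r₀)). Then ((r·cos φ + (R − r₀))/R)² + (r·sin φ)²/(R² − (R − r₀)²) = 1. (This shows that inside an Eaton lens of radius R, each geodesic arc lies on an ellipse.) -/
/-- Inside an Eaton lens of radius `R`, a geodesic arc lies on an ellipse: if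
`0 < r₀ < R`, `r > 0` and `cos φ = −(Rr − r₀(2R − r₀))/(r(R − r₀))`, then
`((r cos φ + (R − r₀))/R)² + (r sin φ)²/(R² − (R − r₀)²) = 1`. -/
theorem stmt_15 (R r₀ r φ : ℝ) (h0 : 0 < r₀) (hr₀ : r₀ < R) (hr : 0 < r)
    (hcos : Real.cos φ = -(R * r - r₀ * (2 * R - r₀)) / (r * (R - r₀))) :
    ((r * Real.cos φ + (R - r₀)) / R) ^ 2 +
      (r * Real.sin φ) ^ 2 / (R ^ 2 - (R - r₀) ^ 2) = 1 := by
  have hR : R ≠ 0 := (h0.trans hr₀).ne'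
  have hd : R - r₀ ≠ 0 := (sub_pos.mpr hr₀).ne'
  have hb : R ^ 2 - (R - r₀) ^ 2 ≠ 0 := by
    have : 0 < r₀ * (2 * R - r₀) := mul_pos h0 (by linarith)
    nlinarith
  have hRr : R * r = (R ^ 2 - (R - r₀) ^ 2) - (R - r₀) * (r * Real.cos φ) := by
    rw [eq_div_iff (mul_ne_zero hr.ne' hd)] at hcos
    linear_combination hcos
  have hsin : (r * Real.sin φ) ^ 2 = r ^ 2 - (r * Real.cos φ) ^ 2 := by
    linear_combination r ^ 2 * Real.sin_sq_add_cos_sq φ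
  rw [hsin, div_pow, div_add_div _ _ (pow_ne_zero 2 hR) hb,
    div_eq_one_iff_eq (mul_ne_zero (pow_ne_zero 2 hR) hb)]
  linear_combination
    (R * r + (R ^ 2 - (R - r₀) ^ 2) - (R - r₀) * (r * Real.cos φ)) * hRr
end
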